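/- Any well-defined composition of N = n(n−1)/2 raising operators mapping O_n into T_n equals Φ; likewise any well-defined composition of N lowering operators mapping T_n into O_n equals Ψ. In particular, if |i−j| ≥ 2 then R_i∘R_j = R_j∘R_i in the sense that whenever one side is defined on an admissible triangle, so is the other and they agree. -/

import Mathlib

open Finset
open scoped Classical

/-- Symbols occurring in a triangle: `x i`, `y i` (indices `1,...,n` encoded by `Fin n`),
`a i j`, `b i j` (the edge `{i+1,j+1}` oriented from smaller to larger, resp. larger to
smaller), and the numbers `1,...,n` of the bottom row. -/
inductive TSym (n : ℕ) where
  | x (i : Fin n)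
  | y (i : Fin n)
  | a (i j : Fin n)
  | b (i j : Fin n)
  | num (i : Fin n)
deriving DecidableEq

/-- A triangle of order `n`: row `r` (0-indexed) has `r+1` entries. -/
def Tri (n : ℕ) := ∀ r : Fin n, Fin (r.val + 1) → TSym n

namespace TSym

variable {n : ℕ}

/-- The symbol lies in `𝒳`. -/
def isX : TSym n → Prop
  | .x _ => True
  | .y _ => True
  | _ => False

/-- The symbol lies in `𝒱_k`. -/
def isV (k : ℕ) : TSym n → Prop
  | .a i j => j.val = i.val + k ∧ 0 < k
  | .b i j => j.val = i.val + k ∧ 0 < k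
  | _ => False

/-- Well-formedness of a non-bottom entry: `a i j` and `b i j` require `i < j`;
numbers may not occur. -/
def wf : TSym n → Prop
  | .a i j => i < j
  | .b i j => i < j
  | .num _ => False
  | _ => True

/-- The left value of a symbol lying in a row of rank `t` (values are `1`-based). -/
def lval (t : ℕ) : TSym n → ℤ
  | .x i => (i.val : ℤ) + 1
  | .y j => (j.val : ℤ) + 1 - t
  | .a i _ => (i.val : ℤ) + 1
  | .b i _ => (i.val : ℤ) + 1
  | .num i => (i.val : ℤ) + 1

/-- The right value of a symbol lying in a row of rank `t`. -/
def rval (t : ℕ) : TSym n → ℤ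
  | .x i => (i.val : ℤ) + 1 + t
  | .y j => (j.val : ℤ) + 1
  | .a _ j => (j.val : ℤ) + 1
  | .b _ j => (j.val : ℤ) + 1
  | .num i => (i.val : ℤ) + 1

end TSym

variable {n : ℕ}

/-- Row `r` is an `𝒳`-row. -/
def IsXRow (t : Tri n) (r : Fin n) : Prop := ∀ i, (t r i).isX

/-- Row `r` has all entries in `𝒱_k`. -/
def IsVRowOf (t : Tri n) (r : Fin n) (k : ℕ) : Prop := ∀ i, (t r i).isV k

/-- Row `r` is a `𝒱`-row. -/
def IsVRow (t : Tri n) (r : Fin n) : Prop := ∃ k, IsVRowOf t r k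

/-- The bottom row is `(1,2,...,n)`. -/
def BottomOK (t : Tri n) : Prop :=
  ∀ (r : Fin n), r.val = n - 1 → ∀ i : Fin (r.val + 1),
    t r i = .num ⟨i.val, by have := i.isLt; have := r.isLt; omega⟩

/-- All non-bottom entries are well-formed. -/
def WellFormed (t : Tri n) : Prop :=
  ∀ r : Fin n, r.val < n - 1 → ∀ i, (t r i).wf

/-- `rk m` is the rank of (1-based) row `m`, for `0 ≤ m ≤ n`; Lean row index `r`
corresponds to row `r+1`.  An admissible ranking: the bottom row has rank `0`,
row `n-1` has rank `1`, and going up, an `𝒳`-row keeps the rank while a row whose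
entries lie in `𝒱_k` has rank `k` and raises the rank above it to `k+1`. -/
def IsRanking (t : Tri n) (rk : ℕ → ℕ) : Prop :=
  rk n = 0 ∧ (1 ≤ n → rk (n - 1) = 1) ∧
  ∀ r : Fin n, r.val < n - 1 →
    (IsXRow t r ∧ rk r.val = rk (r.val + 1)) ∨
    (IsVRowOf t r (rk (r.val + 1)) ∧ rk r.val = rk (r.val + 1) + 1)

/-- The monotone diagonal and monotone row properties: for every local arrangement
`v` directly above consecutive entries `u, w`, we require `l(u) ≤ l(v)` (strict when
`u` is a `y`), `r(v) ≤ r(w)` (strict when `w` is an `x`), and `l(u) < l(w)`. -/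
def MonoProps (t : Tri n) (rk : ℕ → ℕ) : Prop :=
  ∀ (r : Fin n) (hr : 1 ≤ r.val) (p : ℕ) (hp : p + 1 < r.val + 1),
    let u := t r ⟨p, by omega⟩
    let w := t r ⟨p + 1, by omega⟩
    let v := t ⟨r.val - 1, by have := r.isLt; omega⟩ ⟨p, by simp only [Fin.val_mk]; omega⟩
    (u.lval (rk (r.val + 1)) ≤ v.lval (rk r.val)) ∧
    ((∃ j, u = .y j) → u.lval (rk (r.val + 1)) < v.lval (rk r.val)) ∧
    (v.rval (rk r.val) ≤ w.rval (rk (r.val + 1))) ∧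
    ((∃ j, w = .x j) → v.rval (rk r.val) < w.rval (rk (r.val + 1))) ∧
    (u.lval (rk (r.val + 1)) < w.lval (rk (r.val + 1)))

/-- Admissibility of a triangle. -/
def IsAdmissible (t : Tri n) : Prop :=
  BottomOK t ∧ WellFormed t ∧ ∃ rk, IsRanking t rk ∧ MonoProps t rk

/-- The rank of the row with Lean index `r` (i.e. of row `r+1`), computed directly:
one more than the number of `𝒱`-rows strictly below it (above the bottom row). -/
noncomputable def rankOf (t : Tri n) (r : ℕ) : ℕ :=
  1 + ((univ : Finset (Fin n)).filter fun s => r < s.val ∧ IsVRow t s).card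

open MvPolynomial in
/-- The weight of a symbol. -/
noncomputable def TSym.weight : TSym n → MvPolynomial (Fin n ⊕ Fin n) ℤ
  | .x i => X (Sum.inl i)
  | .y j => X (Sum.inr j)
  | .a i _ => X (Sum.inl i)
  | .b _ j => X (Sum.inr j)
  | .num _ => 1

/-- The weight of a triangle: the product of the weights of its non-bottom entries. -/
noncomputable def weight (t : Tri n) : MvPolynomial (Fin n ⊕ Fin n) ℤ :=
  ∏ r : Fin n, if r.val < n - 1 then ∏ i, (t r i).weight else 1

/-- The raising operator `R_d` (`1 ≤ d < n`), acting on (paper-indexed) rows `d-1`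
and `d`, i.e. Lean rows `d-2` and `d-1`. -/
noncomputable def Raise (d : ℕ) (t : Tri n) : Tri n := fun r i =>
  if hu : 2 ≤ d ∧ r.val + 2 = d ∧ r.val + 1 < n then
    -- row d-1: swap with the entry diagonally below, else convert to an 𝒳-symbol
    match t r i with
    | .b j k =>
        if t ⟨r.val + 1, hu.2.2⟩ ⟨i.val, by have := i.isLt; simp only [Fin.val_mk]; omega⟩
            = .x j then .x j else .y k
    | .a j k =>
        if t ⟨r.val + 1, hu.2.2⟩ ⟨i.val + 1, by have := i.isLt; simp only [Fin.val_mk]; omega⟩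
            = .y k then .y k else .x j
    | s => s
  else if hl : r.val + 1 = d then
    -- row d: swap with the entry diagonally above, else convert to a 𝒱-symbol
    let tk := rankOf t r.val
    match t r i with
    | .x j =>
        if hi : i.val < r.val then
          match t ⟨r.val - 1, by have := r.isLt; omega⟩
              ⟨i.val, by simp only [Fin.val_mk]; omega⟩ with
          | .b j' k => if j' = j then .b j' k
              else if h2 : j.val + tk < n then .a j ⟨j.val + tk, h2⟩ else .x j
          | _ => if h2 : j.val + tk < n then .a j ⟨j.val + tk, h2⟩ else .x j
        else if h2 : j.val + tk < n then .a j ⟨j.val + tk, h2⟩ else .x j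
    | .y k =>
        if hi : 1 ≤ i.val then
          match t ⟨r.val - 1, by have := r.isLt; omega⟩
              ⟨i.val - 1, by have := i.isLt; simp only [Fin.val_mk]; omega⟩ with
          | .a j k' => if k' = k then .a j k'
              else if h2 : tk ≤ k.val then .b ⟨k.val - tk, by have := k.isLt; omega⟩ k
              else .y k
          | _ => if h2 : tk ≤ k.val then .b ⟨k.val - tk, by have := k.isLt; omega⟩ k
              else .y k
        else if h2 : tk ≤ k.val then .b ⟨k.val - tk, by have := k.isLt; omega⟩ k else .y k
    | s => s
  else t r i

/-- The lowering operator `L_d` (`1 ≤ d < n`), inverse to `R_d`. -/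
noncomputable def Lower (d : ℕ) (t : Tri n) : Tri n := fun r i =>
  if hu : 2 ≤ d ∧ r.val + 2 = d ∧ r.val + 1 < n then
    -- row d-1: swap with the entry diagonally below, else convert to a 𝒱-symbol
    let tk := rankOf t (r.val + 1)
    match t r i with
    | .x j =>
        (match t ⟨r.val + 1, hu.2.2⟩ ⟨i.val, by have := i.isLt; simp only [Fin.val_mk]; omega⟩ with
          | .b j' k => if j' = j then .b j' k
              else if h2 : j.val + tk < n then .a j ⟨j.val + tk, h2⟩ else .x j
          | _ => if h2 : j.val + tk < n then .a j ⟨j.val + tk, h2⟩ else .x j)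
    | .y k =>
        (match t ⟨r.val + 1, hu.2.2⟩
            ⟨i.val + 1, by have := i.isLt; simp only [Fin.val_mk]; omega⟩ with
          | .a j k' => if k' = k then .a j k'
              else if h2 : tk ≤ k.val then .b ⟨k.val - tk, by have := k.isLt; omega⟩ k
              else .y k
          | _ => if h2 : tk ≤ k.val then .b ⟨k.val - tk, by have := k.isLt; omega⟩ k
              else .y k)
    | s => s
  else if hl : r.val + 1 = d then
    -- row d: swap with the entry diagonally above, else convert to an 𝒳-symbol
    match t r i with
    | .b j k =>
        if hi : i.val < r.val then
          (if t ⟨r.val - 1, by have := r.isLt; omega⟩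
              ⟨i.val, by simp only [Fin.val_mk]; omega⟩ = .x j then .x j else .y k)
        else .y k
    | .a j k =>
        if hi : 1 ≤ i.val then
          (if t ⟨r.val - 1, by have := r.isLt; omega⟩
              ⟨i.val - 1, by have := i.isLt; simp only [Fin.val_mk]; omega⟩ = .y k
           then .y k else .x j)
        else .x j
    | s => s
  else t r i

/-- The numerical value of an `𝒳`-symbol or a bottom-row number. -/
def xyval {n : ℕ} : TSym n → ℤ
  | .x i => (i.val : ℤ) + 1
  | .y i => (i.val : ℤ) + 1
  | .a _ _ => 0
  | .b _ _ => 0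
  | .num i => (i.val : ℤ) + 1

/-- `t` is (the triangle encoding of) an oriented complete monotone triangle:
all non-bottom rows are `𝒳`-rows, the underlying numerical triangle is a complete
monotone triangle, and orientations are forced as prescribed: an entry equal to its
lower-left neighbour is an `x` (right-oriented), an entry equal to its lower-right
neighbour is a `y` (left-oriented). -/
def IsOCMTTri {n : ℕ} (t : Tri n) : Prop :=
  BottomOK t ∧
  (∀ r : Fin n, r.val < n - 1 → IsXRow t r) ∧
  (∀ (r : Fin n) (p q : Fin (r.val + 1)), p < q → xyval (t r p) < xyval (t r q)) ∧
  (∀ (r : Fin n) (h : r.val + 1 < n) (p : Fin (r.val + 1)),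
      xyval (t ⟨r.val + 1, h⟩ ⟨p.val, by have := p.isLt; simp only [Fin.val_mk]; omega⟩)
          ≤ xyval (t r p) ∧
      xyval (t r p)
          ≤ xyval (t ⟨r.val + 1, h⟩ ⟨p.val + 1, by have := p.isLt; simp only [Fin.val_mk]; omega⟩)) ∧
  (∀ (r : Fin n) (h : r.val + 1 < n) (p : Fin (r.val + 1)),
      (xyval (t ⟨r.val + 1, h⟩ ⟨p.val, by have := p.isLt; simp only [Fin.val_mk]; omega⟩)
          = xyval (t r p) → ∃ j, t r p = .x j) ∧
      (xyval (t r p)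
          = xyval (t ⟨r.val + 1, h⟩ ⟨p.val + 1, by have := p.isLt; simp only [Fin.val_mk]; omega⟩)
          → ∃ j, t r p = .y j))

/-- `t` is (the triangle encoding of) a tournament on `{1,...,n}`: all non-bottom
rows are `𝒱`-rows, and the `p`-th entry (0-indexed) of the row with Lean index `r`
carries the subscript pair `(p+1, p+1+(n-1-r))`. -/
def IsTournTri {n : ℕ} (t : Tri n) : Prop :=
  BottomOK t ∧
  ∀ (r : Fin n) (hr : r.val < n - 1) (p : Fin (r.val + 1)),
    t r p = .a ⟨p.val, by have := p.isLt; have := r.isLt; omega⟩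
              ⟨p.val + (n - 1 - r.val), by have := p.isLt; omega⟩ ∨
    t r p = .b ⟨p.val, by have := p.isLt; have := r.isLt; omega⟩
              ⟨p.val + (n - 1 - r.val), by have := p.isLt; omega⟩

variable {n : ℕ} in
/-- `raiseBlock m` applies `R_m, R_{m-1}, ..., R_1` in this order,
i.e. it is `R_1 ∘ R_2 ∘ ⋯ ∘ R_m`. -/
noncomputable def raiseBlock : ℕ → Tri n → Tri n
  | 0 => id
  | m + 1 => fun t => raiseBlock m (Raise (m + 1) t)

variable {n : ℕ} in
/-- `PhiFun m = (R_1∘⋯∘R_m) ∘ ⋯ ∘ (R_1∘R_2) ∘ (R_1)`; the map `Φ` is `PhiFun (n-1)`. -/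
noncomputable def PhiFun : ℕ → Tri n → Tri n
  | 0 => id
  | m + 1 => fun t => raiseBlock (m + 1) (PhiFun m t)

variable {n : ℕ} in
/-- `lowerBlock m` is `L_m ∘ ⋯ ∘ L_2 ∘ L_1` (applying `L_1` first). -/
noncomputable def lowerBlock : ℕ → Tri n → Tri n
  | 0 => id
  | m + 1 => fun t => Lower (m + 1) (lowerBlock m t)

variable {n : ℕ} in
/-- `PsiFun m = (L_1) ∘ (L_2∘L_1) ∘ ⋯ ∘ (L_m∘⋯∘L_1)`; the map `Ψ` is `PsiFun (n-1)`. -/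
noncomputable def PsiFun : ℕ → Tri n → Tri n
  | 0 => id
  | m + 1 => fun t => PsiFun m (lowerBlock (m + 1) t)

variable {n : ℕ} in
/-- The hypotheses under which `R_d` is applicable: row `d` is an `𝒳`-row and row
`d-1` is a `𝒱`-row (of the same rank, which is then automatic). -/
def RaiseApp (t : Tri n) (d : ℕ) : Prop :=
  1 ≤ d ∧ ∃ h : d < n, IsXRow t ⟨d - 1, by omega⟩ ∧ (2 ≤ d → IsVRow t ⟨d - 2, by omega⟩)

variable {n : ℕ} in
/-- The hypotheses under which `L_d` is applicable. -/
def LowerApp (t : Tri n) (d : ℕ) : Prop :=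
  1 ≤ d ∧ ∃ h : d < n, IsVRow t ⟨d - 1, by omega⟩ ∧ (2 ≤ d → IsXRow t ⟨d - 2, by omega⟩)

variable {n : ℕ} in
/-- `iterRaise u j` applies `R_{u 0}, R_{u 1}, ..., R_{u (j-1)}` in this order. -/
noncomputable def iterRaise (u : ℕ → ℕ) : ℕ → Tri n → Tri n
  | 0 => id
  | j + 1 => fun t => Raise (u j) (iterRaise u j t)

variable {n : ℕ} in
noncomputable def iterLower (u : ℕ → ℕ) : ℕ → Tri n → Tri n
  | 0 => id
  | j + 1 => fun t => Lower (u j) (iterLower u j t)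

lemma isX_or {n : ℕ} {s : TSym n} (h : s.isX) : (∃ j, s = .x j) ∨ ∃ j, s = .y j := by
  cases s <;> simp_all [TSym.isX]

lemma not_isX_of_isV {n : ℕ} {s : TSym n} {k : ℕ} (h : s.isV k) : ¬ s.isX := by
  cases s <;> simp_all [TSym.isX, TSym.isV]

lemma TSym.lval_x {n : ℕ} (i : Fin n) (k : ℕ) : (TSym.x i).lval k = (i.val : ℤ) + 1 := rfl

lemma TSym.lval_y {n : ℕ} (i : Fin n) (k : ℕ) : (TSym.y i).lval k = (i.val : ℤ) + 1 - k := rfl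

lemma TSym.isX.rval_eq {n : ℕ} {s : TSym n} (h : s.isX) (k : ℕ) : s.rval k = s.lval k + k := by
  cases s <;> simp_all [TSym.isX, TSym.rval, TSym.lval]

lemma TSym.isV.rval_eq {n : ℕ} {s : TSym n} {k : ℕ} (h : s.isV k) (m : ℕ) :
    s.rval m = s.lval m + k := by
  cases s <;> simp_all [TSym.isV, TSym.rval, TSym.lval] <;> omega

/-- Row `d` of `R_d t` is a `𝒱`-row with the left values of row `d` of `t`. -/
lemma Raise_lower_spec {n : ℕ} {t : Tri n} {k : ℕ} (r : Fin n) (i : Fin (r.val + 1))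
    (hk : rankOf t r.val = k) (hX : (t r i).isX)
    (hl : 1 ≤ (t r i).lval k) (hr : (t r i).rval k ≤ n)
    (hV : 1 ≤ r.val → IsVRowOf t ⟨r.val - 1, by omega⟩ k) :
    (Raise (r.val + 1) t r i).isV k ∧
      (Raise (r.val + 1) t r i).lval k = (t r i).lval k := by
  have hk0 : 0 < k := by subst hk; simp [rankOf]
  unfold Raise
  rw [dif_neg (by omega), dif_pos rfl]
  rcases isX_or hX with ⟨j, hj⟩ | ⟨j, hj⟩ <;> simp only [hj, hk] at hl hr ⊢ <;>
    simp only [TSym.lval, TSym.rval] at hl hr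
  · have h2 : j.val + k < n := by omega
    simp only [h2, dite_true]
    split_ifs with hi
    · have := hV (by omega) ⟨i.val, by simp only; omega⟩
      split <;> simp_all [TSym.isV, TSym.lval]
      split_ifs <;> simp_all [TSym.isV, TSym.lval]
    · simp_all [TSym.isV, TSym.lval]
  · have h2 : k ≤ j.val := by omega
    simp only [h2, dite_true]
    split_ifs with hi
    · have := hV (by omega) ⟨i.val - 1, by simp only; omega⟩
      split <;> simp_all [TSym.isV, TSym.lval]
      · split_ifs <;> simp_all [TSym.lval]
        all_goals omega
      · omega
    · simp_all [TSym.isV, TSym.lval]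
      omega

/-- Row `d - 1` of `R_d t`: each entry is an `x` or a `y` strictly between its lower
neighbours. -/
lemma Raise_upper_spec {n : ℕ} {t : Tri n} {k : ℕ} (r : ℕ) (hr : r + 1 < n) (p : ℕ)
    (hp : p < r + 1) {v u w : TSym n}
    (hv : t ⟨r, by omega⟩ ⟨p, hp⟩ = v)
    (hu : t ⟨r + 1, hr⟩ ⟨p, by simp only; omega⟩ = u)
    (hw : t ⟨r + 1, hr⟩ ⟨p + 1, by simp only; omega⟩ = w)
    (hV : v.isV k) (hXu : u.isX) (hXw : w.isX)
    (h1 : u.lval k ≤ v.lval k) (h2 : (∃ j, u = .y j) → u.lval k < v.lval k)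
    (h3 : v.lval k ≤ w.lval k) (h4 : (∃ j, w = .x j) → v.lval k < w.lval k)
    (h5 : u.lval k < w.lval k) :
    ((∃ j, Raise (r + 2) t ⟨r, by omega⟩ ⟨p, hp⟩ = .x j) ∧
      (Raise (r + 2) t ⟨r, by omega⟩ ⟨p, hp⟩).lval (k + 1) = v.lval k ∧
      v.lval k < w.lval k) ∨
    ((∃ j, Raise (r + 2) t ⟨r, by omega⟩ ⟨p, hp⟩ = .y j) ∧
      (Raise (r + 2) t ⟨r, by omega⟩ ⟨p, hp⟩).lval (k + 1) = v.lval k - 1 ∧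
      u.lval k < v.lval k) := by
  unfold Raise
  rw [dif_pos ⟨by omega, rfl, hr⟩]
  simp only [hv, hu, hw]
  rcases v with _ | _ | ⟨i, j⟩ | ⟨i, j⟩ | _ <;> simp only [TSym.isV] at hV
  · simp only
    generalize u.lval k = m at *
    rcases isX_or hXw with ⟨l, rfl⟩ | ⟨l, rfl⟩
    · have := h4 ⟨_, rfl⟩
      simp_all [TSym.lval]
    · by_cases e : l = j
      · subst e
        simp_all [TSym.lval]
        omega
      · have : (l : ℕ) ≠ j := fun h => e (Fin.ext h)
        simp_all [TSym.lval]; omega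
  · simp only
    generalize w.lval k = m at *
    rcases isX_or hXu with ⟨l, rfl⟩ | ⟨l, rfl⟩
    · by_cases e : l = i
      · subst e
        simp_all [TSym.lval]
      · have : (l : ℕ) ≠ i := fun h => e (Fin.ext h)
        simp_all [TSym.lval]; omega
    · have := h2 ⟨_, rfl⟩
      simp_all [TSym.lval]

/-- Row `d - 1` of `L_d t` is a `𝒱`-row whose left values are those of `t`, plus one at
each `y`. -/
lemma Lower_upper_spec {n : ℕ} {t : Tri n} {k : ℕ} (r : ℕ) (hr : r + 1 < n) (p : ℕ)
    (hp : p < r + 1) {v : TSym n} (hk : rankOf t (r + 1) = k)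
    (hv : t ⟨r, by omega⟩ ⟨p, hp⟩ = v)
    (hX : v.isX) (hV : IsVRowOf t ⟨r + 1, hr⟩ k)
    (hl : 1 ≤ v.lval (k + 1)) (hr' : v.rval (k + 1) ≤ n) :
    (Lower (r + 2) t ⟨r, by omega⟩ ⟨p, hp⟩).isV k ∧
    ((∃ j, v = .x j) →
      (Lower (r + 2) t ⟨r, by omega⟩ ⟨p, hp⟩).lval k = v.lval (k + 1)) ∧
    ((∃ j, v = .y j) →
      (Lower (r + 2) t ⟨r, by omega⟩ ⟨p, hp⟩).lval k = v.lval (k + 1) + 1) := by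
  have hk0 : 0 < k := by subst hk; simp [rankOf]
  have hu := hV ⟨p, by simp only; omega⟩
  have hw := hV ⟨p + 1, by simp only; omega⟩
  unfold Lower
  rw [dif_pos ⟨by omega, rfl, hr⟩]
  simp only [hv, hk]
  rcases isX_or hX with ⟨j, rfl⟩ | ⟨j, rfl⟩ <;> simp only [TSym.lval, TSym.rval] at hl hr'
  · have h2 : j.val + k < n := by push_cast at *; omega
    simp only [h2, dite_true]
    split <;> simp_all [TSym.isV, TSym.lval]
    split_ifs <;> simp_all [TSym.isV, TSym.lval]
  · have h2 : k ≤ j.val := by push_cast at *; omega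
    simp only [h2, dite_true]
    split <;> simp_all [TSym.isV, TSym.lval]
    split_ifs <;> simp_all [TSym.isV, TSym.lval]

/-- Row `d` of `L_d t` is an `𝒳`-row with the left values of row `d` of `t`, and its
orientations separate its entries from their upper neighbours. -/
lemma Lower_lower_spec {n : ℕ} {t : Tri n} {k : ℕ} (r : Fin n) (i : Fin (r.val + 1))
    (hV : (t r i).isV k) :
    (Lower (r.val + 1) t r i).isX ∧
    (Lower (r.val + 1) t r i).lval k = (t r i).lval k ∧
    ((∃ j, Lower (r.val + 1) t r i = .y j) →
      (∀ h : i.val < r.val, ∀ j, t ⟨r.val - 1, by omega⟩ ⟨i.val, by simp only; omega⟩ = .x j →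
        (j.val : ℤ) + 1 ≠ (t r i).lval k) ∨
      (∃ _ : 1 ≤ i.val, ∃ j, t ⟨r.val - 1, by omega⟩ ⟨i.val - 1, by simp only; omega⟩ = .y j ∧
        (j.val : ℤ) + 1 = (t r i).lval k + k)) ∧
    ((∃ j, Lower (r.val + 1) t r i = .x j) →
      (∀ h : 1 ≤ i.val, ∀ j, t ⟨r.val - 1, by omega⟩ ⟨i.val - 1, by simp only; omega⟩ = .y j →
        (j.val : ℤ) + 1 ≠ (t r i).lval k + k) ∨
      (∃ _ : i.val < r.val, ∃ j, t ⟨r.val - 1, by omega⟩ ⟨i.val, by simp only; omega⟩ = .x j ∧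
        (j.val : ℤ) + 1 = (t r i).lval k)) := by
  unfold Lower
  rw [dif_neg (by omega), dif_pos rfl]
  rcases hs : t r i with _ | _ | ⟨a, b⟩ | ⟨a, b⟩ | _ <;> simp only [hs, TSym.isV] at hV
  · by_cases hi : 1 ≤ i.val
    · by_cases e : t ⟨r.val - 1, by omega⟩ ⟨i.val - 1, by simp only; omega⟩ = .y b
      · simp only [hi, e, dite_true, if_true]
        refine ⟨trivial, by simp [TSym.lval]; omega, fun _ => Or.inr ⟨trivial, b, rfl, ?_⟩, by simp⟩
        simp [TSym.lval]; omega
      · simp only [hi, e, dite_true, if_false]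
        refine ⟨trivial, by simp [TSym.lval], by simp, fun _ => Or.inl ?_⟩
        intro _ j hj h
        refine e (hj.trans (congrArg _ (Fin.ext ?_)))
        simp [TSym.lval] at h; omega
    · simp only [hi, dite_false]
      exact ⟨trivial, by simp [TSym.lval], by simp, fun _ => Or.inl fun h => h.elim⟩
  · by_cases hi : i.val < r.val
    · by_cases e : t ⟨r.val - 1, by omega⟩ ⟨i.val, by simp only; omega⟩ = .x a
      · simp only [hi, e, dite_true, if_true]
        exact ⟨trivial, by simp [TSym.lval], by simp, fun _ => Or.inr ⟨trivial, a, rfl, rfl⟩⟩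
      · simp only [hi, e, dite_true, if_false]
        refine ⟨trivial, by simp [TSym.lval]; omega, fun _ => Or.inl ?_, by simp⟩
        intro _ j hj h
        refine e (hj.trans (congrArg _ (Fin.ext ?_)))
        simp [TSym.lval] at h; omega
    · simp only [hi, dite_false]
      exact ⟨trivial, by simp [TSym.lval]; omega, fun _ => Or.inl fun h => h.elim, by simp⟩

/-- Admissibility with respect to a given ranking, in terms of left values only. -/
structure AdmissibleAt {n : ℕ} (t : Tri n) (rk : ℕ → ℕ) : Prop where
  bottom : BottomOK t
  ranking : IsRanking t rk
  mono : ∀ (r : ℕ) (h : r + 1 < n) (p : ℕ) (hp : p < r + 1) (u w v : TSym n),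
    t ⟨r + 1, h⟩ ⟨p, by simp only; omega⟩ = u →
    t ⟨r + 1, h⟩ ⟨p + 1, by simp only; omega⟩ = w →
    t ⟨r, by omega⟩ ⟨p, hp⟩ = v →
    u.lval (rk (r + 2)) ≤ v.lval (rk (r + 1)) ∧
    ((∃ j, u = .y j) → u.lval (rk (r + 2)) < v.lval (rk (r + 1))) ∧
    v.lval (rk (r + 1)) + rk (r + 1) ≤ w.lval (rk (r + 2)) + rk (r + 2) ∧
    ((∃ j, w = .x j) → v.lval (rk (r + 1)) + rk (r + 1) < w.lval (rk (r + 2)) + rk (r + 2)) ∧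
    u.lval (rk (r + 2)) < w.lval (rk (r + 2))

lemma IsVRow.not_isXRow {n : ℕ} {t : Tri n} {r : Fin n} (h : IsVRow t r) : ¬ IsXRow t r := by
  obtain ⟨k, hk⟩ := h
  exact fun hX => not_isX_of_isV (hk ⟨0, by omega⟩) (hX _)

lemma BottomOK.not_isVRow {n : ℕ} {t : Tri n} (hb : BottomOK t) {r : Fin n} (hr : r.val = n - 1) :
    ¬ IsVRow t r := by
  rintro ⟨k, hk⟩
  have := hk ⟨0, by omega⟩
  rw [hb r hr] at this
  exact this

namespace IsRanking

variable {n : ℕ} {t : Tri n} {rk : ℕ → ℕ}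

lemma of_isXRow (h : IsRanking t rk) {r : Fin n} (hr : r.val < n - 1) (hX : IsXRow t r) :
    rk r.val = rk (r.val + 1) := by
  rcases h.2.2 r hr with h | h
  · exact h.2
  · exact absurd hX (IsVRow.not_isXRow ⟨_, h.1⟩)

lemma of_isVRow (h : IsRanking t rk) {r : Fin n} (hr : r.val < n - 1) (hV : IsVRow t r) :
    IsVRowOf t r (rk (r.val + 1)) ∧ rk r.val = rk (r.val + 1) + 1 := by
  rcases h.2.2 r hr with h | h
  · exact absurd h.1 hV.not_isXRow
  · exact h

lemma rval_eq (h : IsRanking t rk) (hb : BottomOK t) (r : Fin n) (i : Fin (r.val + 1)) :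
    (t r i).rval (rk (r.val + 1)) = (t r i).lval (rk (r.val + 1)) + rk (r.val + 1) := by
  by_cases hr : r.val < n - 1
  · rcases h.2.2 r hr with h | h
    · exact (h.1 i).rval_eq _
    · exact (h.1 i).rval_eq _
  · have e : r.val = n - 1 := by omega
    have : r.val + 1 = n := by omega
    have h0 : rk (r.val + 1) = 0 := by rw [this, h.1]
    rw [hb r e, h0]
    simp [TSym.rval, TSym.lval]

/-- The rank of a row, computed by counting `𝒱`-rows, is the one given by any ranking. -/
lemma rankOf_eq (h : IsRanking t rk) (hb : BottomOK t) {r : ℕ} (hr : r + 1 < n) :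
    rankOf t r = rk (r + 1) := by
  obtain ⟨c, hc⟩ : ∃ c, r + 2 + c = n := ⟨n - (r + 2), by omega⟩
  induction c generalizing r with
  | zero =>
    have e : rk (r + 1) = 1 := by
      have := h.2.1 (by omega)
      rwa [show n - 1 = r + 1 by omega] at this
    rw [rankOf, e, Finset.filter_eq_empty_iff.2]
    · rfl
    · rintro s - ⟨hs, hV⟩
      exact hb.not_isVRow (by omega) hV
  | succ c ih =>
    have ih' := ih (r := r + 1) (by omega) (by omega)
    have hr1 : r + 1 < n := hr
    have key := h.2.2 ⟨r + 1, hr1⟩ (by simp only; omega)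
    rw [rankOf] at ih' ⊢
    simp only at key
    rcases key with ⟨hX, e⟩ | ⟨hV, e⟩
    · rw [e, ← ih']
      congr 2
      ext s
      simp only [mem_filter, mem_univ, true_and]
      refine and_congr_left fun hV => ⟨fun hs => ?_, by omega⟩
      have : s ≠ ⟨r + 1, hr1⟩ := by
        rintro rfl
        exact hV.not_isXRow hX
      have := Fin.val_ne_of_ne this
      simp only at this
      omega
    · rw [e, ← ih', add_assoc, ← Finset.card_insert_of_notMem (a := (⟨r + 1, hr1⟩ : Fin n))]
      · congr 2
        ext s
        simp only [mem_filter, mem_univ, true_and, mem_insert, Fin.ext_iff]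
        constructor
        · rintro ⟨hs, hV⟩
          by_cases e : s.val = r + 1
          · exact Or.inl e
          · exact Or.inr ⟨by omega, hV⟩
        · rintro (e | ⟨hs, hV⟩)
          · have : s = ⟨r + 1, hr1⟩ := Fin.ext e
            subst this
            exact ⟨by simp, _, hV⟩
          · exact ⟨by omega, hV⟩
      · simp

end IsRanking

namespace AdmissibleAt

variable {n : ℕ} {t : Tri n} {rk : ℕ → ℕ}

lemma _root_.IsAdmissible.exists_admissibleAt (h : IsAdmissible t) : ∃ rk, AdmissibleAt t rk := by
  obtain ⟨hb, -, rk, hrk, hm⟩ := h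
  refine ⟨rk, hb, hrk, ?_⟩
  rintro r h p hp _ _ _ rfl rfl rfl
  obtain ⟨h1, h2, h3, h4, h5⟩ := hm ⟨r + 1, h⟩ (by simp) p (by simp only; omega)
  have e1 := hrk.rval_eq hb ⟨r, by omega⟩ ⟨p, hp⟩
  have e2 := hrk.rval_eq hb ⟨r + 1, h⟩ ⟨p + 1, by simp only; omega⟩
  exact ⟨h1, h2, e1 ▸ e2 ▸ h3, fun hx => e1 ▸ e2 ▸ h4 hx, h5⟩

lemma bounds (h : AdmissibleAt t rk) {r : ℕ} (hr : r < n) {p : ℕ} (hp : p < r + 1) :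
    1 ≤ (t ⟨r, hr⟩ ⟨p, hp⟩).lval (rk (r + 1)) ∧
      (t ⟨r, hr⟩ ⟨p, hp⟩).lval (rk (r + 1)) + rk (r + 1) ≤ n := by
  obtain ⟨c, hc⟩ : ∃ c, r + 1 + c = n := ⟨n - (r + 1), by omega⟩
  induction c generalizing r p with
  | zero =>
    have h0 : rk (r + 1) = 0 := by rw [show r + 1 = n by omega, h.ranking.1]
    rw [h.bottom ⟨r, hr⟩ (by simp only; omega), h0]
    simp [TSym.lval]; omega
  | succ c ih =>
    obtain ⟨h1, -, h3, -⟩ := h.mono r (by omega) p hp _ _ _ rfl rfl rfl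
    have h6 := (ih (r := r + 1) (by omega) (p := p) (by omega) (by omega)).1
    have h7 := (ih (r := r + 1) (by omega) (p := p + 1) (by omega) (by omega)).2
    simp only [show r + 1 + 1 = r + 2 from rfl] at h6 h7
    exact ⟨by omega, by omega⟩

end AdmissibleAt

lemma Raise_of_ne {n : ℕ} (t : Tri n) {d : ℕ} {r : Fin n} (h1 : r.val + 1 ≠ d)
    (h2 : r.val + 2 ≠ d) : Raise d t r = t r := by
  funext i
  unfold Raise
  rw [dif_neg (by tauto), dif_neg h1]

lemma Lower_of_ne {n : ℕ} (t : Tri n) {d : ℕ} {r : Fin n} (h1 : r.val + 1 ≠ d)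
    (h2 : r.val + 2 ≠ d) : Lower d t r = t r := by
  funext i
  unfold Lower
  rw [dif_neg (by tauto), dif_neg h1]

lemma Raise_congr {n : ℕ} {t t' : Tri n} {d : ℕ} (r : Fin n)
    (hrows : ∀ s : Fin n, s.val + 1 = d ∨ s.val + 2 = d → t s = t' s)
    (hr : r.val + 1 = d ∨ r.val + 2 = d)
    (hk : rankOf t (d - 1) = rankOf t' (d - 1)) : Raise d t r = Raise d t' r := by
  funext i
  rcases hr with rfl | rfl
  · unfold Raise
    rw [dif_neg (by omega), dif_pos rfl, dif_neg (by omega), dif_pos rfl]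
    rw [hrows r (Or.inl rfl)]
    rw [Nat.add_sub_cancel] at hk
    simp only [hk]
    by_cases h0 : 1 ≤ r.val
    · simp only [hrows ⟨r.val - 1, by omega⟩ (Or.inr (by simp only; omega))]
    · have h3 : ¬ i.val < r.val := by omega
      have h4 : ¬ 1 ≤ i.val := by omega
      simp only [h3, h4, dite_false]
  · unfold Raise
    by_cases h : r.val + 1 < n
    · rw [dif_pos ⟨by omega, rfl, h⟩, dif_pos ⟨by omega, rfl, h⟩]
      rw [hrows r (Or.inr rfl), hrows ⟨r.val + 1, h⟩ (Or.inl rfl)]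
    · rw [dif_neg (by omega), dif_neg (by omega), dif_neg (by omega), dif_neg (by omega)]
      rw [hrows r (Or.inr rfl)]

lemma Lower_congr {n : ℕ} {t t' : Tri n} {d : ℕ} (r : Fin n)
    (hrows : ∀ s : Fin n, s.val + 1 = d ∨ s.val + 2 = d → t s = t' s)
    (hr : r.val + 1 = d ∨ r.val + 2 = d)
    (hk : rankOf t (d - 1) = rankOf t' (d - 1)) : Lower d t r = Lower d t' r := by
  funext i
  rcases hr with rfl | rfl
  · unfold Lower
    rw [dif_neg (by omega), dif_pos rfl, dif_neg (by omega), dif_pos rfl]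
    rw [hrows r (Or.inl rfl)]
    by_cases h0 : 1 ≤ r.val
    · simp only [hrows ⟨r.val - 1, by omega⟩ (Or.inr (by simp only; omega))]
    · have h3 : ¬ i.val < r.val := by omega
      have h4 : ¬ 1 ≤ i.val := by omega
      simp only [h3, h4, dite_false]
  · unfold Lower
    rw [show r.val + 2 - 1 = r.val + 1 by omega] at hk
    by_cases h : r.val + 1 < n
    · rw [dif_pos ⟨by omega, rfl, h⟩, dif_pos ⟨by omega, rfl, h⟩]
      simp only [hk]
      rw [hrows r (Or.inr rfl), hrows ⟨r.val + 1, h⟩ (Or.inl rfl)]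
    · rw [dif_neg (by omega), dif_neg (by omega), dif_neg (by omega), dif_neg (by omega)]
      rw [hrows r (Or.inr rfl)]

namespace AdmissibleAt

variable {n : ℕ} {t : Tri n} {rk : ℕ → ℕ}

lemma raise (h : AdmissibleAt t rk) {d : ℕ} (ha : RaiseApp t d) :
    AdmissibleAt (Raise d t) (Function.update rk (d - 1) (rk d + 1)) ∧
      (∀ r : Fin n, r.val + 1 = d → IsVRow (Raise d t) r) ∧
      (∀ r : Fin n, r.val + 2 = d → IsXRow (Raise d t) r) := by
  obtain ⟨h1, hd, hX, hV⟩ := ha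
  obtain ⟨e, rfl⟩ : ∃ e, d = e + 1 := ⟨d - 1, by omega⟩
  simp only [Nat.add_sub_cancel] at hX ⊢
  obtain ⟨k, hk⟩ : ∃ k, rk (e + 1) = k := ⟨_, rfl⟩
  have hke : rk e = k := (h.ranking.of_isXRow (by simp only; omega) hX).trans hk
  have hrank : rankOf t e = k := (h.ranking.rankOf_eq h.bottom (by omega)).trans hk
  have hV' : ∀ r (hr : r + 1 = e), IsVRowOf t ⟨r, by omega⟩ k ∧ rk r = k + 1 := by
    rintro r rfl
    have := h.ranking.of_isVRow (r := ⟨r, by omega⟩) (by simp only; omega) (hV (by omega))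
    simpa only [hke] using this
  obtain ⟨rk', hrk'⟩ : ∃ rk', Function.update rk e (rk (e + 1) + 1) = rk' := ⟨_, rfl⟩
  have hk1 : ∀ m, m ≠ e → rk' m = rk m := fun m hm => by
    rw [← hrk', Function.update_of_ne hm]
  have hk2 : rk' e = k + 1 := by rw [← hrk', Function.update_self, hk]
  rw [hrk']
  have hA : ∀ r : Fin n, r.val ≠ e → r.val + 1 ≠ e → Raise (e + 1) t r = t r := fun r h1 h2 =>
    Raise_of_ne t (by omega) (by omega)
  have hB : ∀ p (hp : p < e + 1), (Raise (e + 1) t ⟨e, by omega⟩ ⟨p, hp⟩).isV k ∧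
      (Raise (e + 1) t ⟨e, by omega⟩ ⟨p, hp⟩).lval k = (t ⟨e, by omega⟩ ⟨p, hp⟩).lval k := by
    intro p hp
    have hb := h.bounds (show e < n by omega) hp
    have hr := h.ranking.rval_eq h.bottom ⟨e, by omega⟩ ⟨p, hp⟩
    simp only [hk] at hb hr
    exact Raise_lower_spec ⟨e, by omega⟩ ⟨p, hp⟩ hrank (hX _) hb.1 (by rw [hr]; exact hb.2)
      fun he => (hV' (e - 1) (by simp only at he; omega)).1
  have hC : ∀ r (hr : r + 1 < n) p (hp : p < r + 1), r + 1 = e →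
      ((∃ j, Raise (e + 1) t ⟨r, by omega⟩ ⟨p, hp⟩ = .x j) ∧
        (Raise (e + 1) t ⟨r, by omega⟩ ⟨p, hp⟩).lval (k + 1) =
          (t ⟨r, by omega⟩ ⟨p, hp⟩).lval k ∧
        (t ⟨r, by omega⟩ ⟨p, hp⟩).lval k <
          (t ⟨r + 1, hr⟩ ⟨p + 1, by simp only; omega⟩).lval k) ∨
      ((∃ j, Raise (e + 1) t ⟨r, by omega⟩ ⟨p, hp⟩ = .y j) ∧
        (Raise (e + 1) t ⟨r, by omega⟩ ⟨p, hp⟩).lval (k + 1) =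
          (t ⟨r, by omega⟩ ⟨p, hp⟩).lval k - 1 ∧
        (t ⟨r + 1, hr⟩ ⟨p, by simp only; omega⟩).lval k <
          (t ⟨r, by omega⟩ ⟨p, hp⟩).lval k) := by
    rintro r hr p hp rfl
    obtain ⟨m1, m2, m3, m4, m5⟩ := h.mono r hr p hp _ _ _ rfl rfl rfl
    simp only [hk, hke] at m1 m2 m3 m4 m5
    exact Raise_upper_spec r hr p hp rfl rfl rfl ((hV' r rfl).1 _) (hX _) (hX _) m1 m2
      (by omega) (fun hx => by have := m4 hx; omega) m5
  have hXr : ∀ r : Fin n, r.val + 1 = e → IsXRow (Raise (e + 1) t) r := by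
    intro r hr i
    rcases hC r.val (by omega) i.val i.isLt hr with ⟨⟨j, hj⟩, -⟩ | ⟨⟨j, hj⟩, -⟩
    · exact (congrArg TSym.isX hj).mpr trivial
    · exact (congrArg TSym.isX hj).mpr trivial
  refine ⟨⟨?_, ⟨?_, ?_, ?_⟩, ?_⟩, ?_, ?_⟩
  · intro r hr
    rw [hA r (by omega) (by omega)]
    exact h.bottom r hr
  · rw [hk1 n (by omega), h.ranking.1]
  · intro hn
    by_cases he : n - 1 = e
    · omega
    · rw [hk1 _ he, h.ranking.2.1 hn]
  · intro r hr
    by_cases h1 : r.val = e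
    · obtain rfl : r = ⟨e, Nat.lt_of_succ_lt hd⟩ := Fin.ext h1
      right
      rw [hk1 (e + 1) (by omega), hk]
      exact ⟨fun i => (hB i.val i.isLt).1, hk2⟩
    · by_cases h2 : r.val + 1 = e
      · left
        refine ⟨hXr r h2, ?_⟩
        rw [hk1 r h1, h2, hk2, (hV' r h2).2]
      · rw [hk1 r h1, hk1 _ h2, IsXRow, IsVRowOf, hA r h1 h2]
        exact h.ranking.2.2 r hr
  · rintro r hr p hp u w v hu hw hv
    by_cases h1 : r = e
    · subst h1
      rw [hA _ (by simp) (by simp only; omega)] at hu hw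
      have old := h.mono r hr p hp _ _ _ hu hw rfl
      have hb := (hB p hp).2
      rw [hv] at hb
      rw [hk1 (r + 2) (by omega), hk1 (r + 1) (by omega), hk, hb, ← hk]
      exact old
    · by_cases h2 : r + 1 = e
      · subst h2
        obtain ⟨m1, -, m3, -, m5⟩ := h.mono r hr p hp _ _ _ rfl rfl rfl
        have hbu := hB p (by omega)
        have hbw := hB (p + 1) (by omega)
        have hc := hC r hr p hp rfl
        rw [hu] at hbu
        rw [hw] at hbw
        rw [hv] at hc
        simp only [hk, hke] at m1 m3 m5
        rw [hk1 (r + 2) (by omega), hk2, hk]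
        refine ⟨by omega, ?_, by omega, ?_, by omega⟩
        · rintro ⟨j, rfl⟩
          exact hbu.1.elim
        · rintro ⟨j, rfl⟩
          exact hbw.1.elim
      · by_cases h3 : r + 2 = e
        · subst h3
          rw [hA _ h1 h2] at hv
          obtain ⟨m1, -, m3, -, m5⟩ := h.mono r (by omega) p hp _ _ _ rfl rfl hv
          have hcu := hC (r + 1) (by omega) p (by omega) rfl
          have hcw := hC (r + 1) (by omega) (p + 1) (by omega) rfl
          rw [hu] at hcu
          rw [hw] at hcw
          have hr1 := (hV' (r + 1) rfl).2
          simp only [hke, hr1] at m1 m3 m5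
          rw [hk1 (r + 1) (by omega), hk2, hr1]
          refine ⟨by omega, ?_, by omega, ?_, by omega⟩
          · rintro ⟨j, rfl⟩
            rcases hcu with ⟨⟨j', hj'⟩, -⟩ | hcu
            · cases hj'
            · omega
          · rintro ⟨j, rfl⟩
            rcases hcw with hcw | ⟨⟨j', hj'⟩, -⟩
            · omega
            · cases hj'
        · rw [hA _ h1 h2] at hv
          rw [hA _ (by simp only; omega) (by simp only; omega)] at hu hw
          rw [hk1 _ h2, hk1 _ h3]
          exact h.mono r hr p hp u w v hu hw hv
  · rintro r hr
    obtain rfl : r = ⟨e, Nat.lt_of_succ_lt hd⟩ := Fin.ext (by simp only; omega)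
    exact ⟨k, fun i => (hB i.val i.isLt).1⟩
  · exact fun r hr => hXr r (by omega)

lemma lower (h : AdmissibleAt t rk) {d : ℕ} (ha : LowerApp t d) :
    AdmissibleAt (Lower d t) (Function.update rk (d - 1) (rk d)) ∧
      (∀ r : Fin n, r.val + 1 = d → IsXRow (Lower d t) r) ∧
      (∀ r : Fin n, r.val + 2 = d → IsVRow (Lower d t) r) := by
  obtain ⟨h1, hd, hV, hX⟩ := ha
  obtain ⟨e, rfl⟩ : ∃ e, d = e + 1 := ⟨d - 1, by omega⟩
  simp only [Nat.add_sub_cancel] at hV ⊢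
  obtain ⟨k, hk⟩ : ∃ k, rk (e + 1) = k := ⟨_, rfl⟩
  obtain ⟨hVe, hke⟩ := h.ranking.of_isVRow (by simp only; omega) hV
  simp only [hk] at hVe hke
  have hrank : rankOf t e = k := (h.ranking.rankOf_eq h.bottom (by omega)).trans hk
  have hX' : ∀ r (hr : r + 1 = e), IsXRow t ⟨r, by omega⟩ ∧ rk r = k + 1 := by
    rintro r rfl
    have hX := hX (by omega)
    have := h.ranking.of_isXRow (r := ⟨r, by omega⟩) (by simp only; omega) hX
    exact ⟨hX, this.trans hke⟩
  obtain ⟨rk', hrk'⟩ : ∃ rk', Function.update rk e (rk (e + 1)) = rk' := ⟨_, rfl⟩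
  have hk1 : ∀ m, m ≠ e → rk' m = rk m := fun m hm => by
    rw [← hrk', Function.update_of_ne hm]
  have hk2 : rk' e = k := by rw [← hrk', Function.update_self, hk]
  rw [hrk']
  have hA : ∀ r : Fin n, r.val ≠ e → r.val + 1 ≠ e → Lower (e + 1) t r = t r := fun r h1 h2 =>
    Lower_of_ne t (by omega) (by omega)
  have hB := fun p (hp : p < e + 1) =>
    Lower_lower_spec ⟨e, by omega⟩ ⟨p, hp⟩ (hVe ⟨p, hp⟩)
  have hC : ∀ r (hr : r + 1 < n) p (hp : p < r + 1), r + 1 = e →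
      (Lower (e + 1) t ⟨r, by omega⟩ ⟨p, hp⟩).isV k ∧
      ((∃ j, t ⟨r, by omega⟩ ⟨p, hp⟩ = .x j ∧
        (Lower (e + 1) t ⟨r, by omega⟩ ⟨p, hp⟩).lval k =
          (t ⟨r, by omega⟩ ⟨p, hp⟩).lval (k + 1)) ∨
      (∃ j, t ⟨r, by omega⟩ ⟨p, hp⟩ = .y j ∧
        (Lower (e + 1) t ⟨r, by omega⟩ ⟨p, hp⟩).lval k =
          (t ⟨r, by omega⟩ ⟨p, hp⟩).lval (k + 1) + 1)) := by
    rintro r hr p hp rfl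
    have hb := h.bounds (show r < n by omega) hp
    have hr' := h.ranking.rval_eq h.bottom ⟨r, by omega⟩ ⟨p, hp⟩
    simp only [hke] at hb hr'
    obtain ⟨s1, s2, s3⟩ := Lower_upper_spec r hr p hp hrank rfl ((hX' r rfl).1 _) hVe hb.1
      (by rw [hr']; exact hb.2)
    refine ⟨s1, ?_⟩
    rcases isX_or ((hX' r rfl).1 ⟨p, hp⟩) with ⟨j, hj⟩ | ⟨j, hj⟩
    · exact Or.inl ⟨j, hj, s2 ⟨j, hj⟩⟩
    · exact Or.inr ⟨j, hj, s3 ⟨j, hj⟩⟩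
  have hVr : ∀ r : Fin n, r.val + 1 = e → IsVRowOf (Lower (e + 1) t) r k :=
    fun r hr i => (hC r.val (by omega) i.val i.isLt hr).1
  refine ⟨⟨?_, ⟨?_, ?_, ?_⟩, ?_⟩, ?_, ?_⟩
  · intro r hr
    rw [hA r (by omega) (by omega)]
    exact h.bottom r hr
  · rw [hk1 n (by omega), h.ranking.1]
  · intro hn
    by_cases he : n - 1 = e
    · omega
    · rw [hk1 _ he, h.ranking.2.1 hn]
  · intro r hr
    by_cases h1 : r.val = e
    · obtain rfl : r = ⟨e, Nat.lt_of_succ_lt hd⟩ := Fin.ext h1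
      left
      rw [hk1 (e + 1) (by omega), hk]
      exact ⟨fun i => (hB i.val i.isLt).1, hk2⟩
    · by_cases h2 : r.val + 1 = e
      · right
        rw [hk1 r h1, h2, hk2]
        exact ⟨hVr r h2, (hX' r h2).2⟩
      · rw [hk1 r h1, hk1 _ h2, IsXRow, IsVRowOf, hA r h1 h2]
        exact h.ranking.2.2 r hr
  · rintro r hr p hp u w v hu hw hv
    by_cases h1 : r = e
    · subst h1
      rw [hA _ (by simp) (by simp only; omega)] at hu hw
      have old := h.mono r hr p hp _ _ _ hu hw rfl
      have hb := (hB p hp).2.1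
      simp only [hv] at hb
      rw [hk1 (r + 2) (by omega), hk1 (r + 1) (by omega), hk, hb, ← hk]
      exact old
    · by_cases h2 : r + 1 = e
      · subst h2
        obtain ⟨m1, -, m3, -, m5⟩ := h.mono r hr p hp _ _ _ rfl rfl rfl
        obtain ⟨-, hu1, hu2, -⟩ := hB p (by omega)
        obtain ⟨-, hw1, -, hw2⟩ := hB (p + 1) (by omega)
        obtain ⟨-, hc⟩ := hC r hr p hp rfl
        simp only [hu] at hu1 hu2
        simp only [hw, Nat.add_sub_cancel] at hw1 hw2
        rw [hv] at hc
        simp only [hk, hke] at m1 m3 m5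
        rw [hk1 (r + 2) (by omega), hk2, hk]
        push_cast at m3
        refine ⟨by omega, fun hy => ?_, by omega, fun hx => ?_, by omega⟩
        · rcases hc with ⟨j, hj, hc⟩ | ⟨j, hj, hc⟩
          · rcases hu2 hy with hne | ⟨hp1, j', hj', he⟩
            · have := hne (by omega) j hj
              rw [hj] at hc m1
              simp only [TSym.lval_x] at hc m1
              omega
            · obtain ⟨q, rfl⟩ : ∃ q, p = q + 1 := ⟨p - 1, by omega⟩
              obtain ⟨s, rfl⟩ : ∃ s, r = s + 1 := ⟨r - 1, by omega⟩
              obtain ⟨-, n2, -, n4, -⟩ := h.mono s (by omega) q (by omega) _ _ _ hj' hj rfl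
              have n2 := n2 ⟨j', rfl⟩
              have n4 := n4 ⟨j, rfl⟩
              have e1 := (hX' (s + 1) rfl).2
              rw [hj] at hc
              simp only [hke, e1, TSym.lval_x, TSym.lval_y] at n2 n4 hc
              push_cast at n2
              omega
          · omega
        · rcases hc with ⟨j, hj, hc⟩ | ⟨j, hj, hc⟩
          · omega
          · rcases hw2 hx with hne | ⟨hp1, j', hj', he⟩
            · have := hne (by omega) j hj
              rw [hj] at hc m3
              simp only [TSym.lval_y] at hc m3
              push_cast at hc m3
              omega
            · obtain ⟨s, rfl⟩ : ∃ s, r = s + 1 := ⟨r - 1, by omega⟩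
              obtain ⟨-, n2, -, n4, -⟩ := h.mono s (by omega) p (by omega) _ _ _ hj hj' rfl
              have n2 := n2 ⟨j, rfl⟩
              have n4 := n4 ⟨j', rfl⟩
              have e1 := (hX' (s + 1) rfl).2
              rw [hj] at hc
              simp only [hke, e1, TSym.lval_x, TSym.lval_y] at n2 n4 hc
              push_cast at n2 hc
              omega
      · by_cases h3 : r + 2 = e
        · subst h3
          rw [hA _ h1 h2] at hv
          obtain ⟨m1, m2, m3, m4, m5⟩ := h.mono r (by omega) p hp _ _ _ rfl rfl hv
          obtain ⟨hVu, hcu⟩ := hC (r + 1) (by omega) p (by omega) rfl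
          obtain ⟨hVw, hcw⟩ := hC (r + 1) (by omega) (p + 1) (by omega) rfl
          rw [hu] at hcu hVu
          rw [hw] at hcw hVw
          have hr1 := (hX' (r + 1) rfl).2
          have hcu' : u.lval k ≤ v.lval (k + 1) := by
            simp only [hke, hr1] at m1 m2
            rcases hcu with ⟨j, hj, hc⟩ | ⟨j, hj, hc⟩
            · omega
            · have := m2 ⟨j, hj⟩
              omega
          have hcw' : v.lval (k + 1) < w.lval k := by
            simp only [hke, hr1] at m3 m4
            rcases hcw with ⟨j, hj, hc⟩ | ⟨j, hj, hc⟩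
            · have := m4 ⟨j, hj⟩
              omega
            · omega
          rw [hk1 (r + 1) (by omega), hk2, hr1]
          push_cast
          refine ⟨by omega, ?_, by omega, ?_, by omega⟩
          · rintro ⟨j, rfl⟩
            exact hVu.elim
          · rintro ⟨j, rfl⟩
            exact hVw.elim
        · rw [hA _ h1 h2] at hv
          rw [hA _ (by simp only; omega) (by simp only; omega)] at hu hw
          rw [hk1 _ h2, hk1 _ h3]
          exact h.mono r hr p hp u w v hu hw hv
  · rintro r hr
    obtain rfl : r = ⟨e, Nat.lt_of_succ_lt hd⟩ := Fin.ext (by simp only; omega)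
    exact fun i => (hB i.val i.isLt).1
  · exact fun r hr => ⟨k, hVr r (by omega)⟩

end AdmissibleAt

/-- `StepsTo R k a b`: there is an `R`-path of length `k` from `a` to `b`. -/
def StepsTo {α : Type*} (R : α → α → Prop) : ℕ → α → α → Prop
  | 0, a, b => a = b
  | k + 1, a, b => ∃ c, R a c ∧ StepsTo R k c b

namespace StepsTo

variable {α : Type*} {R : α → α → Prop}

lemma trans {k l : ℕ} {a b c : α} (h : StepsTo R k a b) (h' : StepsTo R l b c) :
    StepsTo R (k + l) a c := by
  induction k generalizing a with
  | zero =>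
    obtain rfl : a = b := h
    rwa [Nat.zero_add]
  | succ k ih =>
    obtain ⟨d, had, hd⟩ := h
    rw [Nat.succ_add]
    exact ⟨d, had, ih hd⟩

lemma single {a b : α} (h : R a b) : StepsTo R 1 a b := ⟨b, h, rfl⟩

/-- In a relation with the diamond property, every first step starts a path of the same
length to a given terminal element. -/
lemma tail_of_diamond (hR : ∀ a b c, R a b → R a c → b = c ∨ ∃ d, R b d ∧ R c d) {s : α}
    (hs : ∀ b, ¬ R s b) {k : ℕ} {a b : α} (h : StepsTo R k a s) (hb : R a b) :
    ∃ l, k = l + 1 ∧ StepsTo R l b s := by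
  induction k generalizing a b with
  | zero =>
    obtain rfl : a = s := h
    exact absurd hb (hs b)
  | succ k ih =>
    obtain ⟨c, hac, hc⟩ := h
    rcases hR a c b hac hb with rfl | ⟨d, hcd, hbd⟩
    · exact ⟨k, rfl, hc⟩
    · obtain ⟨l, rfl, hl⟩ := ih hc hcd
      exact ⟨l + 1, rfl, d, hbd, hl⟩

lemma eq_of_diamond (hR : ∀ a b c, R a b → R a c → b = c ∨ ∃ d, R b d ∧ R c d) {s : α}
    (hs : ∀ b, ¬ R s b) {k : ℕ} {a b : α} (h : StepsTo R k a s) (hb : StepsTo R k a b) :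
    b = s := by
  induction k generalizing a with
  | zero => exact (show a = b from hb).symm.trans h
  | succ k ih =>
    obtain ⟨c, hac, hc⟩ := hb
    obtain ⟨l, hl, hl'⟩ := tail_of_diamond hR hs h hac
    obtain rfl : k = l := by omega
    exact ih hl' hc

end StepsTo

section Rows

variable {n : ℕ} {t t' : Tri n}

lemma isXRow_congr {r : Fin n} (h : t r = t' r) : IsXRow t r ↔ IsXRow t' r := by
  rw [IsXRow, IsXRow, h]

lemma isVRow_congr {r : Fin n} (h : t r = t' r) : IsVRow t r ↔ IsVRow t' r := by
  simp only [IsVRow, IsVRowOf, h]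

lemma raiseApp_iff {d : ℕ} : RaiseApp t d ↔ 1 ≤ d ∧ d < n ∧
    (∀ r : Fin n, r.val + 1 = d → IsXRow t r) ∧ ∀ r : Fin n, r.val + 2 = d → IsVRow t r := by
  constructor
  · rintro ⟨h1, hd, hX, hV⟩
    refine ⟨h1, hd, ?_, ?_⟩
    · rintro ⟨r, hr⟩ rfl
      exact hX
    · rintro ⟨r, hr⟩ rfl
      exact hV (by simp)
  · rintro ⟨h1, hd, hX, hV⟩
    exact ⟨h1, hd, hX _ (by simp only; omega), fun h => hV _ (by simp only; omega)⟩

lemma lowerApp_iff {d : ℕ} : LowerApp t d ↔ 1 ≤ d ∧ d < n ∧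
    (∀ r : Fin n, r.val + 1 = d → IsVRow t r) ∧ ∀ r : Fin n, r.val + 2 = d → IsXRow t r := by
  constructor
  · rintro ⟨h1, hd, hV, hX⟩
    refine ⟨h1, hd, ?_, ?_⟩
    · rintro ⟨r, hr⟩ rfl
      exact hV
    · rintro ⟨r, hr⟩ rfl
      exact hX (by simp)
  · rintro ⟨h1, hd, hV, hX⟩
    exact ⟨h1, hd, hV _ (by simp only; omega), fun h => hX _ (by simp only; omega)⟩

lemma raiseApp_congr {d : ℕ} (h : ∀ s : Fin n, s.val + 1 = d ∨ s.val + 2 = d → t s = t' s) :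
    RaiseApp t d ↔ RaiseApp t' d := by
  rw [raiseApp_iff, raiseApp_iff]
  refine and_congr_right fun _ => and_congr_right fun _ => and_congr ?_ ?_
  · exact forall₂_congr fun r hr => isXRow_congr (h r (Or.inl hr))
  · exact forall₂_congr fun r hr => isVRow_congr (h r (Or.inr hr))

lemma lowerApp_congr {d : ℕ} (h : ∀ s : Fin n, s.val + 1 = d ∨ s.val + 2 = d → t s = t' s) :
    LowerApp t d ↔ LowerApp t' d := by
  rw [lowerApp_iff, lowerApp_iff]
  refine and_congr_right fun _ => and_congr_right fun _ => and_congr ?_ ?_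
  · exact forall₂_congr fun r hr => isVRow_congr (h r (Or.inl hr))
  · exact forall₂_congr fun r hr => isXRow_congr (h r (Or.inr hr))

lemma raiseApp_Raise {i j : ℕ} (hij : i + 2 ≤ j ∨ j + 2 ≤ i) :
    RaiseApp (Raise j t) i ↔ RaiseApp t i :=
  raiseApp_congr fun _ _ => Raise_of_ne t (by omega) (by omega)

lemma lowerApp_Lower {i j : ℕ} (hij : i + 2 ≤ j ∨ j + 2 ≤ i) :
    LowerApp (Lower j t) i ↔ LowerApp t i :=
  lowerApp_congr fun _ _ => Lower_of_ne t (by omega) (by omega)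

lemma RaiseApp.gap {i j : ℕ} (hi : RaiseApp t i) (hj : RaiseApp t j) (hij : i ≠ j) :
    i + 2 ≤ j ∨ j + 2 ≤ i := by
  obtain ⟨hi1, hin, hiX, hiV⟩ := raiseApp_iff.1 hi
  obtain ⟨hj1, hjn, hjX, hjV⟩ := raiseApp_iff.1 hj
  by_contra hc
  rcases (show j = i + 1 ∨ i = j + 1 by omega) with rfl | rfl
  · exact (hjV ⟨i - 1, by omega⟩ (by simp only; omega)).not_isXRow (hiX _ (by simp only; omega))
  · exact (hiV ⟨j - 1, by omega⟩ (by simp only; omega)).not_isXRow (hjX _ (by simp only; omega))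

lemma LowerApp.gap {i j : ℕ} (hi : LowerApp t i) (hj : LowerApp t j) (hij : i ≠ j) :
    i + 2 ≤ j ∨ j + 2 ≤ i := by
  obtain ⟨hi1, hin, hiV, hiX⟩ := lowerApp_iff.1 hi
  obtain ⟨hj1, hjn, hjV, hjX⟩ := lowerApp_iff.1 hj
  by_contra hc
  rcases (show j = i + 1 ∨ i = j + 1 by omega) with rfl | rfl
  · exact (hiV ⟨i - 1, by omega⟩ (by simp only; omega)).not_isXRow (hjX _ (by simp only; omega))
  · exact (hjV ⟨j - 1, by omega⟩ (by simp only; omega)).not_isXRow (hiX _ (by simp only; omega))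

end Rows

namespace AdmissibleAt

variable {n : ℕ} {t : Tri n} {rk : ℕ → ℕ}

lemma Raise_Raise_row (h : AdmissibleAt t rk) {i j : ℕ} (hi : RaiseApp t i) (hj : RaiseApp t j)
    (hij : i + 2 ≤ j ∨ j + 2 ≤ i) (r : Fin n) (hr : r.val + 1 = i ∨ r.val + 2 = i) :
    Raise i (Raise j t) r = Raise i t r := by
  obtain ⟨hi1, hin, -⟩ := hi
  refine Raise_congr r (fun s hs => Raise_of_ne t (by omega) (by omega)) hr ?_
  rw [(h.raise hj).1.ranking.rankOf_eq (h.raise hj).1.bottom (by omega),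
    h.ranking.rankOf_eq h.bottom (by omega), Function.update_of_ne (by omega)]

lemma Raise_comm (h : AdmissibleAt t rk) {i j : ℕ} (hi : RaiseApp t i) (hj : RaiseApp t j)
    (hij : i + 2 ≤ j ∨ j + 2 ≤ i) : Raise i (Raise j t) = Raise j (Raise i t) := by
  funext r
  by_cases hri : r.val + 1 = i ∨ r.val + 2 = i
  · rw [h.Raise_Raise_row hi hj hij r hri, Raise_of_ne (Raise i t) (by omega) (by omega)]
  · rw [Raise_of_ne (Raise j t) (by omega) (by omega)]
    by_cases hrj : r.val + 1 = j ∨ r.val + 2 = j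
    · rw [h.Raise_Raise_row hj hi hij.symm r hrj]
    · rw [Raise_of_ne (Raise i t) (by omega) (by omega), Raise_of_ne t (by omega) (by omega),
        Raise_of_ne t (by omega) (by omega)]

lemma Lower_Lower_row (h : AdmissibleAt t rk) {i j : ℕ} (hi : LowerApp t i) (hj : LowerApp t j)
    (hij : i + 2 ≤ j ∨ j + 2 ≤ i) (r : Fin n) (hr : r.val + 1 = i ∨ r.val + 2 = i) :
    Lower i (Lower j t) r = Lower i t r := by
  obtain ⟨hi1, hin, -⟩ := hi
  refine Lower_congr r (fun s hs => Lower_of_ne t (by omega) (by omega)) hr ?_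
  rw [(h.lower hj).1.ranking.rankOf_eq (h.lower hj).1.bottom (by omega),
    h.ranking.rankOf_eq h.bottom (by omega), Function.update_of_ne (by omega)]

lemma Lower_comm (h : AdmissibleAt t rk) {i j : ℕ} (hi : LowerApp t i) (hj : LowerApp t j)
    (hij : i + 2 ≤ j ∨ j + 2 ≤ i) : Lower i (Lower j t) = Lower j (Lower i t) := by
  funext r
  by_cases hri : r.val + 1 = i ∨ r.val + 2 = i
  · rw [h.Lower_Lower_row hi hj hij r hri, Lower_of_ne (Lower i t) (by omega) (by omega)]
  · rw [Lower_of_ne (Lower j t) (by omega) (by omega)]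
    by_cases hrj : r.val + 1 = j ∨ r.val + 2 = j
    · rw [h.Lower_Lower_row hj hi hij.symm r hrj]
    · rw [Lower_of_ne (Lower i t) (by omega) (by omega), Lower_of_ne t (by omega) (by omega),
        Lower_of_ne t (by omega) (by omega)]

end AdmissibleAt

section Steps

variable {n : ℕ}

/-- A single applicable raising step out of an admissible triangle. -/
def RaiseStep (a b : Tri n) : Prop :=
  (∃ rk, AdmissibleAt a rk) ∧ ∃ d, RaiseApp a d ∧ b = Raise d a

/-- A single applicable lowering step out of an admissible triangle. -/
def LowerStep (a b : Tri n) : Prop :=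
  (∃ rk, AdmissibleAt a rk) ∧ ∃ d, LowerApp a d ∧ b = Lower d a

lemma RaiseStep.diamond (a b c : Tri n) (hb : RaiseStep a b) (hc : RaiseStep a c) :
    b = c ∨ ∃ d, RaiseStep b d ∧ RaiseStep c d := by
  obtain ⟨⟨rk, h⟩, i, hi, rfl⟩ := hb
  obtain ⟨-, j, hj, rfl⟩ := hc
  by_cases hij : i = j
  · exact Or.inl (by rw [hij])
  · have hg := hi.gap hj hij
    exact Or.inr ⟨_, ⟨⟨_, (h.raise hi).1⟩, j, (raiseApp_Raise hg.symm).2 hj, rfl⟩,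
      ⟨_, (h.raise hj).1⟩, i, (raiseApp_Raise hg).2 hi, (h.Raise_comm hi hj hg).symm⟩

lemma LowerStep.diamond (a b c : Tri n) (hb : LowerStep a b) (hc : LowerStep a c) :
    b = c ∨ ∃ d, LowerStep b d ∧ LowerStep c d := by
  obtain ⟨⟨rk, h⟩, i, hi, rfl⟩ := hb
  obtain ⟨-, j, hj, rfl⟩ := hc
  by_cases hij : i = j
  · exact Or.inl (by rw [hij])
  · have hg := hi.gap hj hij
    exact Or.inr ⟨_, ⟨⟨_, (h.lower hi).1⟩, j, (lowerApp_Lower hg.symm).2 hj, rfl⟩,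
      ⟨_, (h.lower hj).1⟩, i, (lowerApp_Lower hg).2 hi, (h.Lower_comm hi hj hg).symm⟩

lemma not_raiseStep {s : Tri n} (hs : ∀ r : Fin n, r.val < n - 1 → IsVRow s r) (b : Tri n) :
    ¬ RaiseStep s b := by
  rintro ⟨-, d, ⟨h1, hd, hX, -⟩, -⟩
  exact (hs _ (by simp only; omega)).not_isXRow hX

lemma not_lowerStep {s : Tri n} (hs : ∀ r : Fin n, r.val < n - 1 → IsXRow s r) (b : Tri n) :
    ¬ LowerStep s b := by
  rintro ⟨-, d, ⟨h1, hd, hV, -⟩, -⟩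
  exact hV.not_isXRow (hs _ (by simp only; omega))

lemma raiseBlock_spec {m : ℕ} (hm : m < n) {t : Tri n} (h : ∃ rk, AdmissibleAt t rk)
    (hV : ∀ r : Fin n, r.val + 1 < m → IsVRow t r)
    (hX : ∀ r : Fin n, r.val + 1 = m → IsXRow t r) :
    StepsTo RaiseStep m t (raiseBlock m t) ∧ (∃ rk, AdmissibleAt (raiseBlock m t) rk) ∧
      (∀ r : Fin n, r.val < m → IsVRow (raiseBlock m t) r) ∧
      ∀ r : Fin n, m ≤ r.val → raiseBlock m t r = t r := by
  induction m generalizing t with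
  | zero => exact ⟨rfl, h, by simp, fun _ _ => rfl⟩
  | succ m ih =>
    obtain ⟨rk, h⟩ := h
    have ha : RaiseApp t (m + 1) :=
      raiseApp_iff.2 ⟨by omega, hm, hX, fun r hr => hV r (by omega)⟩
    obtain ⟨h1, h2, h3⟩ := h.raise ha
    have hrow : ∀ r : Fin n, r.val ≠ m → r.val + 1 ≠ m → Raise (m + 1) t r = t r :=
      fun r _ _ => Raise_of_ne t (by omega) (by omega)
    obtain ⟨i1, i2, i3, i4⟩ := ih (by omega) ⟨_, h1⟩
      (fun r hr => (isVRow_congr (hrow r (by omega) (by omega))).2 (hV r (by omega)))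
      (fun r hr => h3 r (by omega))
    refine ⟨⟨_, ⟨⟨rk, h⟩, m + 1, ha, rfl⟩, i1⟩, i2, fun r hr => ?_, fun r hr => ?_⟩
    · by_cases hrm : r.val < m
      · exact i3 r hrm
      · exact (isVRow_congr (i4 r (by omega))).2 (h2 r (by omega))
    · exact (i4 r (by omega)).trans (hrow r (by omega) (by omega))

lemma PhiFun_spec {m : ℕ} (hm : m ≤ n - 1) {t : Tri n} (h : ∃ rk, AdmissibleAt t rk)
    (hX : ∀ r : Fin n, r.val < n - 1 → IsXRow t r) :
    StepsTo RaiseStep ((m + 1).choose 2) t (PhiFun m t) ∧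
      (∃ rk, AdmissibleAt (PhiFun m t) rk) ∧
      (∀ r : Fin n, r.val < m → IsVRow (PhiFun m t) r) ∧
      ∀ r : Fin n, m ≤ r.val → PhiFun m t r = t r := by
  induction m with
  | zero => exact ⟨rfl, h, by simp, fun _ _ => rfl⟩
  | succ m ih =>
    obtain ⟨i1, i2, i3, i4⟩ := ih (by omega)
    obtain ⟨j1, j2, j3, j4⟩ := raiseBlock_spec (m := m + 1) (by omega) i2
      (fun r hr => i3 r (by omega))
      (fun r hr => (isXRow_congr (i4 r (by omega))).2 (hX r (by omega)))
    refine ⟨?_, j2, j3, fun r hr => (j4 r hr).trans (i4 r (by omega))⟩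
    rw [Nat.choose_succ_succ (m + 1) 1, Nat.choose_one_right, Nat.add_comm]
    exact i1.trans j1

lemma lowerBlock_spec {m : ℕ} (hm : m < n) {t : Tri n} (h : ∃ rk, AdmissibleAt t rk)
    (hV : ∀ r : Fin n, r.val < m → IsVRow t r) :
    StepsTo LowerStep m t (lowerBlock m t) ∧ (∃ rk, AdmissibleAt (lowerBlock m t) rk) ∧
      (∀ r : Fin n, r.val + 1 < m → IsVRow (lowerBlock m t) r) ∧
      (∀ r : Fin n, r.val + 1 = m → IsXRow (lowerBlock m t) r) ∧
      ∀ r : Fin n, m ≤ r.val → lowerBlock m t r = t r := by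
  induction m with
  | zero => exact ⟨rfl, h, by simp, by simp, fun _ _ => rfl⟩
  | succ m ih =>
    obtain ⟨i1, ⟨rk, i2⟩, i3, i4, i5⟩ := ih (by omega) fun r hr => hV r (by omega)
    have ha : LowerApp (lowerBlock m t) (m + 1) :=
      lowerApp_iff.2 ⟨by omega, hm,
        fun r hr => (isVRow_congr (i5 r (by omega))).2 (hV r (by omega)),
        fun r hr => i4 r (by omega)⟩
    obtain ⟨h1, h2, h3⟩ := i2.lower ha
    have hrow : ∀ r : Fin n, r.val ≠ m → r.val + 1 ≠ m →
        lowerBlock (m + 1) t r = lowerBlock m t r :=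
      fun r _ _ => Lower_of_ne _ (by omega) (by omega)
    refine ⟨i1.trans (.single ⟨⟨rk, i2⟩, m + 1, ha, rfl⟩), ⟨_, h1⟩, fun r hr => ?_, h2,
      fun r hr => (hrow r (by omega) (by omega)).trans (i5 r (by omega))⟩
    by_cases hrm : r.val + 1 = m
    · exact h3 r (by omega)
    · exact (isVRow_congr (hrow r (by omega) hrm)).2 (i3 r (by omega))

lemma PsiFun_spec {m : ℕ} (hm : m ≤ n - 1) {t : Tri n} (h : ∃ rk, AdmissibleAt t rk)
    (hV : ∀ r : Fin n, r.val < m → IsVRow t r)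
    (hX : ∀ r : Fin n, m ≤ r.val → r.val < n - 1 → IsXRow t r) :
    StepsTo LowerStep ((m + 1).choose 2) t (PsiFun m t) ∧
      ∀ r : Fin n, r.val < n - 1 → IsXRow (PsiFun m t) r := by
  induction m generalizing t with
  | zero => exact ⟨rfl, fun r hr => hX r (by omega) hr⟩
  | succ m ih =>
    obtain ⟨j1, j2, j3, j4, j5⟩ := lowerBlock_spec (m := m + 1) (by omega) h hV
    obtain ⟨i1, i2⟩ := ih (by omega) j2 (fun r hr => j3 r (by omega)) fun r hr hr' => by
      by_cases hrm : r.val = m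
      · exact j4 r (by omega)
      · exact (isXRow_congr (j5 r (by omega))).2 (hX r (by omega) hr')
    refine ⟨?_, i2⟩
    rw [Nat.choose_succ_succ (m + 1) 1, Nat.choose_one_right]
    exact j1.trans i1

lemma iterRaise_steps {u : ℕ → ℕ} {k : ℕ} {t : Tri n} (h : ∃ rk, AdmissibleAt t rk)
    (hu : ∀ j < k, RaiseApp (iterRaise u j t) (u j)) :
    StepsTo RaiseStep k t (iterRaise u k t) ∧ ∃ rk, AdmissibleAt (iterRaise u k t) rk := by
  induction k with
  | zero => exact ⟨rfl, h⟩
  | succ k ih =>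
    obtain ⟨i1, rk, i2⟩ := ih fun j hj => hu j (by omega)
    have ha := hu k (by omega)
    exact ⟨i1.trans (.single ⟨⟨rk, i2⟩, u k, ha, rfl⟩), _, (i2.raise ha).1⟩

lemma iterLower_steps {u : ℕ → ℕ} {k : ℕ} {t : Tri n} (h : ∃ rk, AdmissibleAt t rk)
    (hu : ∀ j < k, LowerApp (iterLower u j t) (u j)) :
    StepsTo LowerStep k t (iterLower u k t) ∧ ∃ rk, AdmissibleAt (iterLower u k t) rk := by
  induction k with
  | zero => exact ⟨rfl, h⟩
  | succ k ih =>
    obtain ⟨i1, rk, i2⟩ := ih fun j hj => hu j (by omega)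
    have ha := hu k (by omega)
    exact ⟨i1.trans (.single ⟨⟨rk, i2⟩, u k, ha, rfl⟩), _, (i2.lower ha).1⟩

end Steps

lemma TSym.isX.lval_one {n : ℕ} {s : TSym n} (h : s.isX) :
    ((∃ j, s = .x j) ∧ (¬ ∃ j, s = .y j) ∧ s.lval 1 = xyval s) ∨
      ((¬ ∃ j, s = .x j) ∧ (∃ j, s = .y j) ∧ s.lval 1 = xyval s - 1) := by
  rcases isX_or h with ⟨j, rfl⟩ | ⟨j, rfl⟩
  · exact Or.inl ⟨⟨j, rfl⟩, by simp, rfl⟩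
  · exact Or.inr ⟨by simp, ⟨j, rfl⟩, by rw [lval_y]; rfl⟩

lemma IsOCMTTri.admissibleAt {n : ℕ} {t : Tri n} (h : IsOCMTTri t) :
    AdmissibleAt t fun m => if m < n then 1 else 0 := by
  obtain ⟨hb, hX, hlt, hle, ho⟩ := h
  refine ⟨hb, ⟨by simp, fun hn => if_pos (by omega), fun r hr => Or.inl ⟨hX r hr, ?_⟩⟩, ?_⟩
  · exact (if_pos (by omega)).trans (if_pos (by omega)).symm
  · intro r hr p hp u w v hu hw hv
    have hle1 := hle ⟨r, by omega⟩ hr ⟨p, hp⟩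
    have ho1 := ho ⟨r, by omega⟩ hr ⟨p, hp⟩
    have hlt1 := hlt ⟨r + 1, hr⟩ ⟨p, by simp only; omega⟩ ⟨p + 1, by simp only; omega⟩
      (by simp [Fin.lt_def])
    have hXv := hX ⟨r, by omega⟩ (by simp only; omega) ⟨p, hp⟩
    simp only [hu, hv, hw] at hle1 ho1 hlt1 hXv
    rw [if_pos hr]
    have hv1 := hXv.lval_one
    by_cases hr2 : r + 2 < n
    · rw [if_pos hr2]
      have hXu := hX ⟨r + 1, hr⟩ (by simp only; omega) ⟨p, by simp only; omega⟩
      have hXw := hX ⟨r + 1, hr⟩ (by simp only; omega) ⟨p + 1, by simp only; omega⟩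
      have hleu := hle ⟨r + 1, hr⟩ hr2 ⟨p, by simp only; omega⟩
      have hou := ho ⟨r + 1, hr⟩ hr2 ⟨p, by simp only; omega⟩
      have hlew := hle ⟨r + 1, hr⟩ hr2 ⟨p + 1, by simp only; omega⟩
      have how := ho ⟨r + 1, hr⟩ hr2 ⟨p + 1, by simp only; omega⟩
      simp only [hu, hw] at hXu hXw hleu hou hlew how
      have hu1 := hXu.lval_one
      have hw1 := hXw.lval_one
      generalize (∃ j, u = .x j) = ux at *
      generalize (∃ j, u = .y j) = uy at *
      generalize (∃ j, w = .x j) = wx at *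
      generalize (∃ j, w = .y j) = wy at *
      generalize (∃ j, v = .x j) = vx at *
      generalize (∃ j, v = .y j) = vy at *
      refine ⟨?_, ?_, ?_, ?_, ?_⟩ <;> grind
    · rw [if_neg hr2]
      have hbu := hb ⟨r + 1, hr⟩ (by simp only; omega) ⟨p, by simp only; omega⟩
      have hbw := hb ⟨r + 1, hr⟩ (by simp only; omega) ⟨p + 1, by simp only; omega⟩
      rw [hu] at hbu
      rw [hw] at hbw
      have hu1 : u.lval 0 = xyval u ∧ ¬ ∃ j, u = .y j := by rw [hbu]; exact ⟨rfl, by simp⟩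
      have hw1 : w.lval 0 = xyval w ∧ ¬ ∃ j, w = .x j := by rw [hbw]; exact ⟨rfl, by simp⟩
      clear hbu hbw
      generalize (∃ j, u = .y j) = uy at *
      generalize (∃ j, w = .x j) = wx at *
      generalize (∃ j, v = .x j) = vx at *
      generalize (∃ j, v = .y j) = vy at *
      refine ⟨?_, ?_, ?_, ?_, ?_⟩ <;> grind

lemma IsTournTri.isV {n : ℕ} {t : Tri n} (h : IsTournTri t) (r : Fin n) (hr : r.val < n - 1) :
    IsVRowOf t r (n - (r.val + 1)) := by
  intro p
  rcases h.2 r hr p with h | h <;> rw [h] <;> exact ⟨by simp only; omega, by omega⟩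

lemma IsTournTri.lval {n : ℕ} {t : Tri n} (h : IsTournTri t) (r : Fin n) (p : Fin (r.val + 1))
    (k : ℕ) : (t r p).lval k = (p.val : ℤ) + 1 ∧ ¬ (t r p).isX := by
  by_cases hr : r.val < n - 1
  · rcases h.2 r hr p with h | h <;> rw [h] <;> exact ⟨rfl, id⟩
  · rw [h.1 r (by omega)]
    exact ⟨rfl, id⟩

lemma IsTournTri.admissibleAt {n : ℕ} {t : Tri n} (h : IsTournTri t) :
    AdmissibleAt t fun m => n - m := by
  refine ⟨h.1, ⟨by simp, fun hn => by simp only; omega,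
    fun r hr => Or.inr ⟨h.isV r hr, by simp only; omega⟩⟩, ?_⟩
  rintro r hr p hp u w v rfl rfl rfl
  have h1 := h.lval ⟨r, by omega⟩ ⟨p, hp⟩
  have h2 := h.lval ⟨r + 1, hr⟩ ⟨p, by simp only; omega⟩
  have h3 := h.lval ⟨r + 1, hr⟩ ⟨p + 1, by simp only; omega⟩
  simp only [(h1 _).1, (h2 _).1, (h3 _).1]
  push_cast
  refine ⟨le_rfl, ?_, by omega, ?_, by omega⟩
  · rintro ⟨j, hj⟩
    exact ((h2 0).2 (hj ▸ trivial)).elim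
  · rintro ⟨j, hj⟩
    exact ((h3 0).2 (hj ▸ trivial)).elim

/-- Any well-defined composition of `N = n(n-1)/2` raising operators from `𝒪_n` to
`𝒯_n` equals `Φ`; dually for lowering operators and `Ψ`.  Moreover raising operators
with indices at distance `≥ 2` commute, in the strong sense that if one side is
defined so is the other, and they agree. -/
theorem stmt18 (n : ℕ) :
    (∀ u : ℕ → ℕ,
      (∀ t : Tri n, IsOCMTTri t → ∀ j < n.choose 2, RaiseApp (iterRaise u j t) (u j)) →
      ∀ t : Tri n, IsOCMTTri t → iterRaise u (n.choose 2) t = PhiFun (n - 1) t) ∧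
    (∀ u : ℕ → ℕ,
      (∀ t : Tri n, IsTournTri t → ∀ j < n.choose 2, LowerApp (iterLower u j t) (u j)) →
      ∀ t : Tri n, IsTournTri t → iterLower u (n.choose 2) t = PsiFun (n - 1) t) ∧
    (∀ (t : Tri n) (i j : ℕ), IsAdmissible t → 2 ≤ ((i : ℤ) - j).natAbs →
      ((RaiseApp t j ∧ RaiseApp (Raise j t) i) ↔ (RaiseApp t i ∧ RaiseApp (Raise i t) j)) ∧
      (RaiseApp t j → RaiseApp (Raise j t) i → Raise i (Raise j t) = Raise j (Raise i t))) := by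
  have hn : (n - 1 + 1).choose 2 = n.choose 2 := by
    cases n <;> rfl
  refine ⟨fun u hu t ht => ?_, fun u hu t ht => ?_, fun t i j ht hij => ?_⟩
  · obtain ⟨h1, -, h3, -⟩ := PhiFun_spec le_rfl ⟨_, ht.admissibleAt⟩ ht.2.1
    exact (hn ▸ h1).eq_of_diamond RaiseStep.diamond (not_raiseStep h3)
      (iterRaise_steps ⟨_, ht.admissibleAt⟩ (hu t ht)).1
  · obtain ⟨h1, h2⟩ := PsiFun_spec le_rfl ⟨_, ht.admissibleAt⟩
      (fun r hr => ⟨_, ht.isV r hr⟩) fun r hr hr' => by omega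
    exact (hn ▸ h1).eq_of_diamond LowerStep.diamond (not_lowerStep h2)
      (iterLower_steps ⟨_, ht.admissibleAt⟩ (hu t ht)).1
  · have hg : i + 2 ≤ j ∨ j + 2 ≤ i := by omega
    obtain ⟨rk, h⟩ := ht.exists_admissibleAt
    rw [raiseApp_Raise hg, raiseApp_Raise hg.symm]
    exact ⟨and_comm, fun hj hi => h.Raise_comm hi hj hg⟩
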